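/- If two decompositions (h_k, …, h_1) and (g_k, …, g_1) of the same polynomial are both obtained from a decomposition (f_k, …, f_1) by a Ritt swap at the same index i, then (h_k, …, h_1) is linearly equivalent to (g_k, …, g_1). -/

import Mathlib

open Polynomial

noncomputable section

/-- A linear polynomial `L(x) = Ax + B` with `A ≠ 0`, i.e. of degree exactly 1. -/
def IsLinearPoly (L : ℂ[X]) : Prop := L.natDegree = 1

/-- A polynomial over ℂ is indecomposable if it has degree at least 2 and cannot be
written as the composition of two polynomials each of degree at least 2. -/
def Indecomposable (f : ℂ[X]) : Prop :=
  2 ≤ f.natDegree ∧ ¬ ∃ g h : ℂ[X], 2 ≤ g.natDegree ∧ 2 ≤ h.natDegree ∧ f = g.comp h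

/-- A decomposition of `f` is a nonempty list `[f₁, …, f_k]` (innermost factor first) of
indecomposable polynomials with `f = f_k ∘ ⋯ ∘ f₁`. -/
def IsDecomposition (l : List ℂ[X]) (f : ℂ[X]) : Prop :=
  l ≠ [] ∧ (∀ p ∈ l, Indecomposable p) ∧ l.foldl (fun q p => p.comp q) X = f

/-- `f` is the degree-`n` Chebyshev polynomial: the unique polynomial with
`f(x + 1/x) = x^n + 1/x^n` for all `x ≠ 0`. -/
def IsChebyshev (n : ℕ) (f : ℂ[X]) : Prop :=
  ∀ x : ℂ, x ≠ 0 → f.eval (x + x⁻¹) = x ^ n + x⁻¹ ^ n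

/-- A ritty polynomial: an indecomposable polynomial equal to `x²`, or `x^p` (`p` an odd
prime), or the Chebyshev polynomial `C_p` (`p` an odd prime), or
`x^k · u(x^ℓ)^n` with `k ≥ 1`, `gcd(k,ℓ) = gcd(k,n) = 1`, `u` monic non-constant,
`u(0) ≠ 0`, and `ℓ > 1` or `n > 1`. -/
def IsRitty (f : ℂ[X]) : Prop :=
  Indecomposable f ∧
  (f = X ^ 2 ∨
   (∃ p : ℕ, p.Prime ∧ Odd p ∧ f = X ^ p) ∨
   (∃ p : ℕ, p.Prime ∧ Odd p ∧ IsChebyshev p f) ∨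
   (∃ (k el n : ℕ) (u : ℂ[X]), 1 ≤ k ∧ 1 ≤ el ∧ 1 ≤ n ∧
     Nat.gcd k el = 1 ∧ Nat.gcd k n = 1 ∧
     u.Monic ∧ 0 < u.natDegree ∧ u.eval 0 ≠ 0 ∧ (1 < el ∨ 1 < n) ∧
     f = X ^ k * (u.comp (X ^ el)) ^ n))

/-- `a ∘ b = c ∘ d` is an instance of a basic Ritt identity:
`x^p ∘ x^q = x^q ∘ x^p` for distinct primes `p ≠ q`;
`C_p ∘ C_q = C_q ∘ C_p` for distinct odd primes;
or `x^p ∘ (x^k·u(x^{ℓp})^n) = (x^k·u(x^ℓ)^{pn}) ∘ x^p` (in either orientation),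
with both non-monomial factors ritty. -/
def BasicRittIdentity (a b c d : ℂ[X]) : Prop :=
  a.comp b = c.comp d ∧
  ((∃ p q : ℕ, p.Prime ∧ q.Prime ∧ p ≠ q ∧
      a = X ^ p ∧ b = X ^ q ∧ c = X ^ q ∧ d = X ^ p) ∨
   (∃ p q : ℕ, p.Prime ∧ q.Prime ∧ Odd p ∧ Odd q ∧ p ≠ q ∧
      IsChebyshev p a ∧ IsChebyshev q b ∧ IsChebyshev q c ∧ IsChebyshev p d) ∨
   (∃ (p k el n : ℕ) (u : ℂ[X]), p.Prime ∧
      a = X ^ p ∧ b = X ^ k * (u.comp (X ^ (el * p))) ^ n ∧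
      c = X ^ k * (u.comp (X ^ el)) ^ (p * n) ∧ d = X ^ p ∧
      IsRitty b ∧ IsRitty c) ∨
   (∃ (p k el n : ℕ) (u : ℂ[X]), p.Prime ∧
      a = X ^ k * (u.comp (X ^ el)) ^ (p * n) ∧ b = X ^ p ∧
      c = X ^ p ∧ d = X ^ k * (u.comp (X ^ (el * p))) ^ n ∧
      IsRitty a ∧ IsRitty d))

/-- `m` is obtained from `l` by a Ritt swap at (0-based) position `j`, i.e. at the pair of
factors in positions `j` and `j+1` (innermost factor first).  This says the other
factors agree and there are linear polynomials `L, M, N` with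
`(L⁻¹ ∘ l_{j+1} ∘ M) ∘ (M⁻¹ ∘ l_j ∘ N) = R ∘ S` a basic Ritt identity,
`m_{j+1} = L ∘ R` and `m_j = S ∘ N⁻¹`; inverses are eliminated by cross-multiplying. -/
def RittSwapAt (j : ℕ) (l m : List ℂ[X]) : Prop :=
  l.length = m.length ∧ j + 1 < l.length ∧
  (∀ i, i ≠ j → i ≠ j + 1 → l.getD i 0 = m.getD i 0) ∧
  ∃ L M N A B R S : ℂ[X],
    IsLinearPoly L ∧ IsLinearPoly M ∧ IsLinearPoly N ∧
    L.comp A = (l.getD (j + 1) 0).comp M ∧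
    M.comp B = (l.getD j 0).comp N ∧
    BasicRittIdentity A B R S ∧
    m.getD (j + 1) 0 = L.comp R ∧
    (m.getD j 0).comp N = S

/-- Linear equivalence of decompositions `[l₁,…,l_k]` and `[m₁,…,m_k]` (innermost first):
there are linear polynomials `L₁, …, L_{k-1}` (with `L₀ = L_k = x` the identity) such
that `m_i = L_i⁻¹ ∘ l_i ∘ L_{i-1}` for each `i`; inverses are eliminated by
cross-multiplying. -/
def LinearEquivalent (l m : List ℂ[X]) : Prop :=
  l.length = m.length ∧
  ∃ L : ℕ → ℂ[X], L 0 = X ∧ L l.length = X ∧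
    (∀ i, 0 < i → i < l.length → IsLinearPoly (L i)) ∧
    ∀ i < l.length, (L (i + 1)).comp (m.getD i 0) = (l.getD i 0).comp (L i)

theorem comp_right_cancel {p q d : ℂ[X]} (hd : 0 < d.natDegree) (h : p.comp d = q.comp d) :
    p = q := by
  have h0 : (p - q).comp d = 0 := by rw [sub_comp, h, sub_self]
  rcases comp_eq_zero_iff.mp h0 with h1 | ⟨-, h2⟩
  · exact sub_eq_zero.mp h1
  · rw [h2, natDegree_C] at hd
    exact absurd hd (lt_irrefl 0)

/-- The factor `∑ b ^ i * d ^ (m - 1 - i)` of `b ^ m - d ^ m` has full degree when `b` and `d` are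
monic of the same degree. -/
theorem coeff_geom_sum_of_monic {b d : ℂ[X]} (hb : b.Monic) (hd : d.Monic)
    (hbd : b.natDegree = d.natDegree) (m : ℕ) :
    (∑ i ∈ Finset.range m, b ^ i * d ^ (m - 1 - i)).coeff ((m - 1) * d.natDegree) = m := by
  rw [finsetSum_coeff, Finset.sum_congr rfl (g := fun _ => 1)]
  · simp
  · intro i hi
    have him : i + (m - 1 - i) = m - 1 := by
      have := Finset.mem_range.mp hi
      omega
    have hmonic := (hb.pow i).mul (hd.pow (m - 1 - i))
    have hdeg : (b ^ i * d ^ (m - 1 - i)).natDegree = (m - 1) * d.natDegree := by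
      rw [(hb.pow i).natDegree_mul (hd.pow _), hb.natDegree_pow, hd.natDegree_pow, hbd,
        ← add_mul, him]
    rw [← hdeg]
    exact hmonic

theorem exists_sub_eq_C_of_monic {b d : ℂ[X]} (hb : b.Monic) (hd : d.Monic)
    (hbd : b.natDegree = d.natDegree) {m : ℕ} (hm : 0 < m)
    (h : (b ^ m - d ^ m).natDegree ≤ (m - 1) * d.natDegree) :
    ∃ e : ℂ, b - d = C e := by
  set Q := ∑ i ∈ Finset.range m, b ^ i * d ^ (m - 1 - i) with hQ
  have hcoeff : Q.coeff ((m - 1) * d.natDegree) ≠ 0 := by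
    rw [hQ, coeff_geom_sum_of_monic hb hd hbd]
    exact_mod_cast hm.ne'
  have hQ0 : Q ≠ 0 := fun h0 => hcoeff (by rw [h0, coeff_zero])
  have hle : (m - 1) * d.natDegree ≤ Q.natDegree := le_natDegree_of_ne_zero hcoeff
  by_cases hz : b - d = 0
  · exact ⟨0, by rw [hz, C_0]⟩
  · rw [← geom_sum₂_mul, ← hQ, natDegree_mul hQ0 hz] at h
    exact ⟨_, eq_C_of_natDegree_eq_zero (by omega)⟩

theorem natDegree_comp_sub_leadingCoeff_mul_pow_le (a b : ℂ[X]) :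
    (a.comp b - C a.leadingCoeff * b ^ a.natDegree).natDegree
      ≤ (a.natDegree - 1) * b.natDegree := by
  have h : a.comp b - C a.leadingCoeff * b ^ a.natDegree = a.eraseLead.comp b := by
    have := congrArg (fun q : ℂ[X] => q.comp b) a.eraseLead_add_C_mul_X_pow
    simp only [add_comp, mul_comp, C_comp, X_pow_comp] at this
    rw [← this, add_sub_cancel_right]
  rw [h, natDegree_comp]
  exact Nat.mul_le_mul_right _ a.eraseLead_natDegree_le

/-- Two decompositions of a polynomial into two factors whose right factors have the same degree
differ by a linear polynomial. -/
theorem exists_linear_of_comp_eq_comp {a b c d : ℂ[X]} (h : a.comp b = c.comp d)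
    (hbd : b.natDegree = d.natDegree) (ha : 0 < a.natDegree) (hd : 0 < d.natDegree) :
    ∃ L : ℂ[X], IsLinearPoly L ∧ b = L.comp d ∧ c = a.comp L := by
  have hac : a.natDegree = c.natDegree := by
    have := congrArg natDegree h
    rw [natDegree_comp, natDegree_comp, hbd] at this
    exact Nat.eq_of_mul_eq_mul_right hd this
  have hb0 : b ≠ 0 := fun h0 => by simp [h0] at hbd; omega
  have hd0 : d ≠ 0 := fun h0 => by simp [h0] at hd
  have ha0 : a ≠ 0 := fun h0 => by simp [h0] at ha
  have hβ : b.leadingCoeff ≠ 0 := leadingCoeff_ne_zero.mpr hb0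
  have hδ : d.leadingCoeff ≠ 0 := leadingCoeff_ne_zero.mpr hd0
  have hα : a.leadingCoeff ≠ 0 := leadingCoeff_ne_zero.mpr ha0
  have hlead : a.leadingCoeff * b.leadingCoeff ^ a.natDegree
      = c.leadingCoeff * d.leadingCoeff ^ a.natDegree := by
    have := congrArg leadingCoeff h
    rwa [leadingCoeff_comp (by omega), leadingCoeff_comp hd.ne', ← hac] at this
  set β := b.leadingCoeff with hβdef
  set δ := d.leadingCoeff with hδdef
  set m := a.natDegree with hm
  have hbmonic : (C β⁻¹ * b).Monic := monic_C_mul_of_mul_leadingCoeff_eq_one (inv_mul_cancel₀ hβ)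
  have hdmonic : (C δ⁻¹ * d).Monic := monic_C_mul_of_mul_leadingCoeff_eq_one (inv_mul_cancel₀ hδ)
  have hbdeg : (C β⁻¹ * b).natDegree = b.natDegree := natDegree_C_mul (inv_ne_zero hβ)
  have hddeg : (C δ⁻¹ * d).natDegree = d.natDegree := natDegree_C_mul (inv_ne_zero hδ)
  have hpow : C (a.leadingCoeff * β ^ m) * ((C β⁻¹ * b) ^ m - (C δ⁻¹ * d) ^ m)
      = (c.comp d - C c.leadingCoeff * d ^ m) - (a.comp b - C a.leadingCoeff * b ^ m) := by
    rw [h, mul_sub]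
    conv_lhs => enter [2]; rw [hlead]
    have hβ' : (C β : ℂ[X]) ^ m * C β⁻¹ ^ m = 1 := by
      rw [← mul_pow, ← C_mul, mul_inv_cancel₀ hβ, C_1, one_pow]
    have hδ' : (C δ : ℂ[X]) ^ m * C δ⁻¹ ^ m = 1 := by
      rw [← mul_pow, ← C_mul, mul_inv_cancel₀ hδ, C_1, one_pow]
    simp only [C_mul, C_pow, mul_pow]
    linear_combination C a.leadingCoeff * b ^ m * hβ' - C c.leadingCoeff * d ^ m * hδ'
  have hdegle : ((C β⁻¹ * b) ^ m - (C δ⁻¹ * d) ^ m).natDegree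
      ≤ (m - 1) * (C δ⁻¹ * d).natDegree := by
    rw [← natDegree_C_mul (mul_ne_zero hα (pow_ne_zero m hβ)), hpow, hddeg]
    refine (natDegree_sub_le _ _).trans (max_le ?_ ?_)
    · rw [hac]
      exact natDegree_comp_sub_leadingCoeff_mul_pow_le c d
    · rw [← hbd]
      exact natDegree_comp_sub_leadingCoeff_mul_pow_le a b
  obtain ⟨e, he⟩ :=
    exists_sub_eq_C_of_monic hbmonic hdmonic (by rw [hbdeg, hddeg, hbd]) ha hdegle
  have hb : b = (C (β * δ⁻¹) * X + C (β * e)).comp d := by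
    have hβ' : (C β : ℂ[X]) * C β⁻¹ = 1 := by rw [← C_mul, mul_inv_cancel₀ hβ, C_1]
    simp only [add_comp, mul_comp, C_comp, X_comp, C_mul]
    linear_combination C β * he - b * hβ'
  refine ⟨_, natDegree_linear (mul_ne_zero hβ (inv_ne_zero hδ)), hb, ?_⟩
  exact comp_right_cancel hd (by rw [comp_assoc, ← hb, h])

theorem IsChebyshev.unique {n : ℕ} {p q : ℂ[X]} (hp : IsChebyshev n p) (hq : IsChebyshev n q) :
    p = q := by
  refine Polynomial.funext fun y => ?_
  obtain ⟨x, hx⟩ := IsAlgClosed.exists_root (X ^ 2 - C y * X + 1 : ℂ[X]) (by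
    have : (X ^ 2 - C y * X + 1 : ℂ[X]).degree = 2 := by compute_degree!
    simp [this])
  simp only [IsRoot.def, eval_add, eval_sub, eval_mul, eval_pow, eval_X, eval_C, eval_one] at hx
  have hx0 : x ≠ 0 := by
    rintro rfl
    simp at hx
  have hy : y = x + x⁻¹ := by
    field_simp
    linear_combination -hx
  rw [hy, hp x hx0, hq x hx0]

theorem IsRitty.ne_zero {f : ℂ[X]} (hf : IsRitty f) : f ≠ 0 := by
  rintro rfl
  simpa using hf.1.1

theorem natDegree_X_pow_mul_comp_pow {k el n p : ℕ} {u : ℂ[X]}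
    (h₁ : X ^ k * (u.comp (X ^ el)) ^ (p * n) ≠ 0)
    (h₂ : X ^ k * (u.comp (X ^ (el * p))) ^ n ≠ 0) :
    (X ^ k * (u.comp (X ^ el)) ^ (p * n)).natDegree
      = (X ^ k * (u.comp (X ^ (el * p))) ^ n).natDegree := by
  rw [natDegree_mul (left_ne_zero_of_mul h₁) (right_ne_zero_of_mul h₁),
    natDegree_mul (left_ne_zero_of_mul h₂) (right_ne_zero_of_mul h₂)]
  simp only [natDegree_pow, natDegree_comp, natDegree_X]
  ring

/-- In a basic Ritt identity `a ∘ b = c ∘ d` the degrees of the factors are interchanged. -/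
theorem BasicRittIdentity.natDegree_eq {a b c d : ℂ[X]} (h : BasicRittIdentity a b c d) :
    a.natDegree = d.natDegree := by
  rcases h.2 with ⟨p, q, -, -, -, rfl, -, -, rfl⟩ | ⟨p, q, -, -, -, -, -, ha, -, -, hd⟩ |
    ⟨p, k, el, n, u, -, rfl, -, -, rfl, -, -⟩ | ⟨p, k, el, n, u, -, rfl, -, -, rfl, ha, hd⟩
  · rfl
  · rw [ha.unique hd]
  · rfl
  · exact natDegree_X_pow_mul_comp_pow ha.ne_zero hd.ne_zero

theorem RittSwapAt.comp_eq {j : ℕ} {l m : List ℂ[X]} (h : RittSwapAt j l m) :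
    (m.getD (j + 1) 0).comp (m.getD j 0) = (l.getD (j + 1) 0).comp (l.getD j 0) := by
  obtain ⟨-, -, -, L, M, N, A, B, R, S, -, -, hN, hA, hB, hAB, hR, hS⟩ := h
  have hN' : 0 < N.natDegree := by rw [show N.natDegree = 1 from hN]; exact one_pos
  refine comp_right_cancel hN' ?_
  rw [comp_assoc, comp_assoc, hS, hR, ← hB, comp_assoc, ← hAB.1, ← comp_assoc, hA, comp_assoc]

theorem RittSwapAt.natDegree_eq {j : ℕ} {l m : List ℂ[X]} (h : RittSwapAt j l m) :
    (m.getD j 0).natDegree = (l.getD (j + 1) 0).natDegree := by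
  obtain ⟨-, -, -, L, M, N, A, B, R, S, hL, hM, hN, hA, -, hAB, -, hS⟩ := h
  have h₁ := congrArg natDegree hA
  have h₂ := congrArg natDegree hS
  rw [natDegree_comp, natDegree_comp, show L.natDegree = 1 from hL,
    show M.natDegree = 1 from hM, one_mul, mul_one] at h₁
  rw [natDegree_comp, show N.natDegree = 1 from hN, mul_one] at h₂
  rw [h₂, ← hAB.natDegree_eq, h₁]

/-- If two decompositions `h` and `g` of the same polynomial are both obtained from a
decomposition `l` of `f` by a Ritt swap at the same index `j`, then `h` and `g` are
linearly equivalent. -/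
theorem ritt_swap_well_defined (f : ℂ[X]) (l h g : List ℂ[X]) (j : ℕ)
    (hl : IsDecomposition l f)
    (hh : RittSwapAt j l h) (hg : RittSwapAt j l g) :
    LinearEquivalent h g := by
  have hlen := hh.2.1
  have hdeg : ∀ i < l.length, 2 ≤ (l.getD i 0).natDegree := fun i hi => by
    rw [List.getD_eq_getElem _ _ hi]
    exact (hl.2.1 _ (List.getElem_mem hi)).1
  have h₀ := hdeg j (by omega)
  have h₁ := hdeg (j + 1) hlen
  have hcomp := hh.comp_eq
  have hpos : 0 < (h.getD (j + 1) 0).natDegree := by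
    have := congrArg natDegree hcomp
    rw [natDegree_comp, natDegree_comp] at this
    exact Nat.pos_of_ne_zero fun h0 => by
      rw [h0, zero_mul, eq_comm, mul_eq_zero] at this
      omega
  obtain ⟨L, hL, hL₁, hL₂⟩ := exists_linear_of_comp_eq_comp (hcomp.trans hg.comp_eq.symm)
    (hh.natDegree_eq.trans hg.natDegree_eq.symm) hpos (by rw [hg.natDegree_eq]; omega)
  refine ⟨hh.1.symm.trans hg.1, fun i => if i = j + 1 then L else X, by simp, ?_, ?_, ?_⟩
  · exact if_neg (by rw [← hh.1]; omega)
  · intro i _ _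
    dsimp only
    split_ifs
    · exact hL
    · exact natDegree_X
  · intro i _
    dsimp only
    rcases eq_or_ne i j with rfl | hij
    · rw [if_pos rfl, if_neg (by omega), comp_X, hL₁]
    · rcases eq_or_ne i (j + 1) with rfl | hij'
      · rw [if_neg (by omega), if_pos rfl, X_comp, hL₂]
      · rw [if_neg (by omega), if_neg hij', X_comp, comp_X, ← hh.2.2.1 i hij hij',
          hg.2.2.1 i hij hij']
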